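/- Let p be a prime, k ≥ 2, and let G = γ₁ × γ₂ × ⋯ × γ_k be a torus such that for each i the number of vertices of γ_i equals 2^{q_i}·p^{r_i} for some integers q_i ≥ 1 and r_i ≥ 0. Then mrl(G) ≥ ⌊k/2⌋ + 1. -/

import Mathlib

/-!
A torus is the Cartesian (box) product of cycle graphs `γ₁ × ⋯ × γ_k` where
`γ_i` is a cycle on `sz i ≥ 3` vertices.  We model its vertex set as
`∀ i, ZMod (sz i)`, with two vertices adjacent when they differ in exactly one
coordinate, by `±1` around that cycle.  A Hamiltonian cycle is a cyclic
enumeration `f : ZMod N → V` (with `N` the number of vertices) which is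
bijective and takes consecutive vertices to adjacent vertices.  The run length
of a Hamiltonian cycle is the largest `r ≥ 1` such that any `r` consecutive
edges contain at most one edge in any single dimension, and `mrl` is the
maximum run length over all Hamiltonian cycles.
-/

/-- Vertices of the torus with dimension sizes `sz`. -/
def TorusVtx (k : ℕ) (sz : Fin k → ℕ) : Type := ∀ i : Fin k, ZMod (sz i)

/-- The number of vertices of the torus with dimension sizes `sz`. -/
def torusCard (k : ℕ) (sz : Fin k → ℕ) : ℕ := ∏ i : Fin k, sz i

/-- Adjacency in the torus: the two vertices differ in exactly one coordinate,
and there by one step around the corresponding cycle. -/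
def TorusAdj {k : ℕ} {sz : Fin k → ℕ} (u v : TorusVtx k sz) : Prop :=
  ∃ i : Fin k, (v i = u i + 1 ∨ u i = v i + 1) ∧ ∀ j : Fin k, j ≠ i → u j = v j

/-- A Hamiltonian cycle of the torus, as a cyclic enumeration of all of its
vertices in which consecutive vertices are adjacent. -/
def IsHamCycle {k : ℕ} {sz : Fin k → ℕ}
    (f : ZMod (torusCard k sz) → TorusVtx k sz) : Prop :=
  Function.Bijective f ∧ ∀ t, TorusAdj (f t) (f (t + 1))

/-- The edge of the cycle `f` at position `s` (joining `f s` to `f (s+1)`)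
is in dimension `i`, i.e. its endpoints differ in coordinate `i`. -/
def EdgeInDim {k : ℕ} {sz : Fin k → ℕ}
    (f : ZMod (torusCard k sz) → TorusVtx k sz) (i : Fin k)
    (s : ZMod (torusCard k sz)) : Prop :=
  f s i ≠ f (s + 1) i

/-- Any `r` consecutive edges of the cycle `f` (read cyclically) contain at
most one edge in any single dimension. -/
def WindowOk {k : ℕ} {sz : Fin k → ℕ}
    (f : ZMod (torusCard k sz) → TorusVtx k sz) (r : ℕ) : Prop :=
  ∀ (t : ZMod (torusCard k sz)) (i : Fin k) (a b : ℕ), a < r → b < r → a ≠ b →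
    ¬(EdgeInDim f i (t + (a : ZMod (torusCard k sz))) ∧
      EdgeInDim f i (t + (b : ZMod (torusCard k sz))))

/-- The run length of a Hamiltonian cycle: the largest `r ≥ 1` such that any
`r` consecutive edges contain at most one edge in any single dimension. -/
noncomputable def runLength {k : ℕ} {sz : Fin k → ℕ}
    (f : ZMod (torusCard k sz) → TorusVtx k sz) : ℕ :=
  sSup {r : ℕ | 1 ≤ r ∧ WindowOk f r}

/-- The maximum run length of the torus: the maximum of `runLength` over all
of its Hamiltonian cycles. -/
noncomputable def mrl (k : ℕ) (sz : Fin k → ℕ) : ℕ :=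
  sSup {m : ℕ | ∃ f, IsHamCycle (k := k) (sz := sz) f ∧ m = runLength f}

/-- The coordinates in `S` carry a cyclic Gray code of run length at least `r`: a sequence `f`
whose restriction to `S` is periodic with period `∏ i ∈ S, sz i` and injective on a period,
together with the dimension `e t ∈ S` in which its step at time `t` takes place. -/
def HasRun {ι : Type*} (sz : ι → ℕ) (S : Finset ι) (r : ℕ) : Prop :=
  ∃ (f : ℕ → ∀ i, ZMod (sz i)) (e : ℕ → ι),
    (∀ t, e t ∈ S) ∧
    (∀ t, f (t + 1) (e t) = f t (e t) + 1 ∨ f t (e t) = f (t + 1) (e t) + 1) ∧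
    (∀ t, ∀ j ∈ S, j ≠ e t → f (t + 1) j = f t j) ∧
    (∀ s t, (∀ i ∈ S, f s i = f t i) ↔ s ≡ t [MOD ∏ i ∈ S, sz i]) ∧
    (∀ s t, s < t → t < s + r → e s ≠ e t)

theorem hasRun_singleton {ι : Type*} (sz : ι → ℕ) (i : ι) : HasRun sz {i} 1 := by
  refine ⟨fun t _ => (t : ZMod _), fun _ => i, by simp, fun t => Or.inl (by push_cast; rfl), ?_, ?_,
    fun s t h1 h2 => by omega⟩
  · intro t j hj hne
    exact absurd (Finset.mem_singleton.mp hj) hne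
  · intro s t
    simp [ZMod.natCast_eq_natCast_iff]

theorem modEq_mul_iff_zigzag {a b : ℕ} (ha : 0 < a) (s t : ℕ) :
    ((s + 1) / 2 ≡ (t + 1) / 2 [MOD 2 * a] ∧
      2 * (s / (4 * a)) + s / 2 % 2 ≡ 2 * (t / (4 * a)) + t / 2 % 2 [MOD 2 * b]) ↔
    s ≡ t [MOD 4 * a * b] := by
  constructor
  · rintro ⟨h1, h2⟩
    have h1' : (s + 1) / 2 % 2 = (t + 1) / 2 % 2 := h1.of_mul_right a
    have h2' : (2 * (s / (4 * a)) + s / 2 % 2) % 2 = (2 * (t / (4 * a)) + t / 2 % 2) % 2 :=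
      h2.of_mul_right b
    have hpar : s % 2 = t % 2 := by omega
    have hpar' : s / 2 % 2 = t / 2 % 2 := by omega
    have h3 : s ≡ t [MOD 4 * a] := by
      have h := (h1.mul_left' 2)
      rw [← mul_assoc] at h
      have hs : 2 * ((s + 1) / 2) = s + s % 2 := by omega
      have ht : 2 * ((t + 1) / 2) = t + t % 2 := by omega
      rw [hs, ht, hpar] at h
      exact Nat.ModEq.add_right_cancel' _ h
    have h4 : s / (4 * a) ≡ t / (4 * a) [MOD b] := by
      rw [hpar'] at h2
      exact Nat.ModEq.mul_left_cancel' two_ne_zero (Nat.ModEq.add_right_cancel' _ h2)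
    have h5 := (h4.mul_left' (4 * a)).add_right (s % (4 * a))
    rw [Nat.div_add_mod] at h5
    rw [show s % (4 * a) = t % (4 * a) from h3, Nat.div_add_mod] at h5
    exact h5
  · have key : ∀ s c : ℕ, ((s + 1) / 2 ≡ (s + 4 * a * b * c + 1) / 2 [MOD 2 * a] ∧
      2 * (s / (4 * a)) + s / 2 % 2 ≡
        2 * ((s + 4 * a * b * c) / (4 * a)) + (s + 4 * a * b * c) / 2 % 2 [MOD 2 * b]) := by
      intro s c
      have e1 : (s + 4 * a * b * c + 1) / 2 = (s + 1) / 2 + 2 * a * (b * c) := by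
        rw [show s + 4 * a * b * c + 1 = s + 1 + 2 * (2 * a * (b * c)) by ring,
          Nat.add_mul_div_left _ _ two_pos]
      have e2 : (s + 4 * a * b * c) / (4 * a) = s / (4 * a) + b * c := by
        rw [show s + 4 * a * b * c = s + 4 * a * (b * c) by ring,
          Nat.add_mul_div_left _ _ (by positivity)]
      have e3 : (s + 4 * a * b * c) / 2 % 2 = s / 2 % 2 := by
        rw [show s + 4 * a * b * c = s + 2 * (2 * (a * b * c)) by ring,
          Nat.add_mul_div_left _ _ two_pos, Nat.add_mul_mod_self_left]
      rw [e1, e2, e3]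
      refine ⟨by simp [Nat.ModEq], ?_⟩
      rw [show 2 * (s / (4 * a) + b * c) + s / 2 % 2 =
        2 * (s / (4 * a)) + s / 2 % 2 + 2 * b * c by ring]
      simp [Nat.ModEq]
    intro h
    rcases le_total s t with hst | hst
    · obtain ⟨c, hc⟩ := (Nat.modEq_iff_dvd' hst).mp h
      obtain rfl : t = s + 4 * a * b * c := by omega
      exact key s c
    · obtain ⟨c, hc⟩ := (Nat.modEq_iff_dvd' hst).mp h.symm
      obtain rfl : s = t + 4 * a * b * c := by omega
      exact ⟨(key t c).1.symm, (key t c).2.symm⟩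

theorem zigzag_step {a t : ℕ} (ht : t % 2 = 1) :
    2 * ((t + 1) / (4 * a)) + (t + 1) / 2 % 2 = 2 * (t / (4 * a)) + t / 2 % 2 + 1 ∨
    2 * (t / (4 * a)) + t / 2 % 2 = 2 * ((t + 1) / (4 * a)) + (t + 1) / 2 % 2 + 1 := by
  by_cases hd : 4 * a ∣ t + 1
  · have h1 : (t + 1) / (4 * a) = t / (4 * a) + 1 := Nat.succ_div_of_dvd hd
    have h4 : 4 ∣ t + 1 := (Dvd.intro _ rfl).trans hd
    left
    rw [h1]
    omega
  · have h1 : (t + 1) / (4 * a) = t / (4 * a) := Nat.succ_div_of_not_dvd hd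
    rw [h1]
    omega

theorem hasRun_pair {ι : Type*} [DecidableEq ι] (sz : ι → ℕ) {i j : ι} (hij : i ≠ j)
    (hi : Even (sz i)) (hi0 : 0 < sz i) (hj : Even (sz j)) : HasRun sz {i, j} 2 := by
  obtain ⟨a, ha⟩ := even_iff_two_dvd.mp hi
  obtain ⟨b, hb⟩ := even_iff_two_dvd.mp hj
  have ha0 : 0 < a := by omega
  set y : ℕ → ℕ := fun t => 2 * (t / (4 * a)) + t / 2 % 2 with hy
  refine ⟨fun t l => if l = i then (((t + 1) / 2 : ℕ) : ZMod (sz l)) else (y t : ZMod (sz l)),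
    fun t => if t % 2 = 0 then i else j, ?_, ?_, ?_, ?_, ?_⟩
  · intro t
    dsimp only
    split_ifs <;> simp
  · intro t
    rcases Nat.mod_two_eq_zero_or_one t with ht | ht
    · left
      simp only [ht, if_true]
      rw [show (t + 1 + 1) / 2 = (t + 1) / 2 + 1 by omega]
      push_cast
      rfl
    · have hdim : (if t % 2 = 0 then i else j) = j := if_neg (by omega)
      beta_reduce
      rw [hdim, if_neg hij.symm, if_neg hij.symm]
      rcases zigzag_step ht with h | h
      · left
        exact_mod_cast congrArg (Nat.cast (R := ZMod (sz j))) h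
      · right
        exact_mod_cast congrArg (Nat.cast (R := ZMod (sz j))) h
  · intro t l hl hne
    rcases Nat.mod_two_eq_zero_or_one t with ht | ht
    · simp only [ht, if_true] at hne
      simp only [hne, if_false]
      have h1 : (t + 1) / (4 * a) = t / (4 * a) := by
        apply Nat.succ_div_of_not_dvd
        intro h
        have : 4 ∣ t + 1 := (Dvd.intro _ rfl).trans h
        omega
      have h2 : (t + 1) / 2 = t / 2 := by omega
      simp only [hy, h1, h2]
    · simp only [ht, one_ne_zero, if_false] at hne
      have hli : l = i := by
        simp only [Finset.mem_insert, Finset.mem_singleton] at hl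
        tauto
      simp only [hli, if_true]
      rw [show (t + 1 + 1) / 2 = (t + 1) / 2 by omega]
  · intro s t
    rw [Finset.prod_pair hij, ha, hb, show 2 * a * (2 * b) = 4 * a * b by ring,
      ← modEq_mul_iff_zigzag ha0]
    simp only [Finset.mem_insert, Finset.mem_singleton, forall_eq_or_imp, forall_eq, if_true,
      hij.symm, if_false, ZMod.natCast_eq_natCast_iff, ha, hb, hy]
  · intro s t h1 h2
    obtain rfl : t = s + 1 := by omega
    dsimp only
    split_ifs <;> first | exact hij | exact hij.symm | omega

theorem HasRun.union {ι : Type*} [DecidableEq ι] {sz : ι → ℕ} {S T : Finset ι}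
    (hST : Disjoint S T) {r₁ r₂ R g h : ℕ} (hS : HasRun sz S r₁) (hT : HasRun sz T r₂)
    (hd : g + h = Nat.gcd (∏ i ∈ S, sz i) (∏ i ∈ T, sz i)) (hpos : 0 < g + h)
    (hg : R * g ≤ r₁ * (g + h)) (hh : R * h ≤ r₂ * (g + h))
    (hord : ∀ z, ∏ i ∈ S, sz i ∣ z * g → ∏ i ∈ T, sz i ∣ z * h →
      Nat.lcm (∏ i ∈ S, sz i) (∏ i ∈ T, sz i) ∣ z) :
    HasRun sz (S ∪ T) R := by
  obtain ⟨f₁, e₁, he₁, hf₁, hc₁, hm₁, hw₁⟩ := hS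
  obtain ⟨f₂, e₂, he₂, hf₂, hc₂, hm₂, hw₂⟩ := hT
  rw [HasRun, Finset.prod_union hST]
  set M := ∏ i ∈ S, sz i
  set N := ∏ i ∈ T, sz i
  set d := g + h with hdef
  have hgd : g ≤ d := by omega
  set u : ℕ → ℕ := fun t => t * g / d with hu
  set v : ℕ → ℕ := fun t => t - u t with hv
  have hlow : ∀ t, d * u t ≤ t * g := fun t => Nat.mul_div_le _ _
  have hupp : ∀ t, t * g < d * u t + d := fun t => Nat.lt_mul_div_succ _ hpos
  have hut : ∀ t, u t ≤ t := fun t =>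
    Nat.div_le_of_le_mul (by rw [mul_comm d]; exact Nat.mul_le_mul_left t hgd)
  have huv : ∀ t, u t + v t = t := fun t => Nat.add_sub_of_le (hut t)
  have humono : ∀ {s t}, s ≤ t → u s ≤ u t := fun hst =>
    Nat.div_le_div_right (Nat.mul_le_mul_right g hst)
  have hstep : ∀ t, u (t + 1) ≤ u t + 1 := by
    intro t
    have h1 := hlow (t + 1)
    have h2 := hupp t
    have : d * u (t + 1) < d * (u t + 2) := by nlinarith
    have := lt_of_mul_lt_mul_left this (Nat.zero_le d)
    omega
  have hvmono : Monotone v := monotone_nat_of_le_succ fun t => by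
    have := hstep t
    have := huv t
    have := huv (t + 1)
    omega
  have hcase : ∀ t, (u (t + 1) = u t + 1 ∧ v (t + 1) = v t) ∨
      (u (t + 1) = u t ∧ v (t + 1) = v t + 1) := by
    intro t
    have := hstep t
    have := humono (Nat.le_add_right t 1)
    have := huv t
    have := huv (t + 1)
    omega
  have hushift : ∀ s n, u (s + d * n) = u s + g * n := by
    intro s n
    simp only [hu]
    rw [show (s + d * n) * g = s * g + d * (g * n) by ring, Nat.add_mul_div_left _ _ hpos]
  have hvshift : ∀ s n, v (s + d * n) = v s + h * n := by
    intro s n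
    have h1 := huv s
    have h2 := huv (s + d * n)
    rw [hushift] at h2
    have : d * n = g * n + h * n := by rw [hdef, add_mul]
    omega
  have hMN : M * N = d * Nat.lcm M N := by rw [hd, Nat.gcd_mul_lcm]
  have hmodle : ∀ s t, s ≤ t →
      ((u s ≡ u t [MOD M] ∧ v s ≡ v t [MOD N]) ↔ s ≡ t [MOD M * N]) := by
    intro s t hst
    rw [Nat.modEq_iff_dvd' hst, Nat.modEq_iff_dvd' (humono hst),
      Nat.modEq_iff_dvd' (hvmono hst)]
    constructor
    · rintro ⟨h1, h2⟩
      have h3 : d ∣ t - s := by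
        have h4 : t - s = (u t - u s) + (v t - v s) := by
          have := huv s
          have := huv t
          have := humono hst
          have := hvmono hst
          omega
        rw [h4, hd]
        exact dvd_add ((Nat.gcd_dvd_left _ _).trans h1) ((Nat.gcd_dvd_right _ _).trans h2)
      obtain ⟨n, hn⟩ := h3
      obtain rfl : t = s + d * n := by omega
      rw [hushift, Nat.add_sub_cancel_left, mul_comm] at h1
      rw [hvshift, Nat.add_sub_cancel_left, mul_comm] at h2
      rw [hn, hMN]
      exact Nat.mul_dvd_mul_left d (hord n h1 h2)
    · rintro ⟨c, hc⟩
      obtain rfl : t = s + d * (Nat.lcm M N * c) := by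
        rw [← mul_assoc, ← hMN]
        omega
      rw [hushift, hvshift, Nat.add_sub_cancel_left, Nat.add_sub_cancel_left]
      exact ⟨Dvd.dvd.mul_left ((Nat.dvd_lcm_left M N).mul_right c) g,
        Dvd.dvd.mul_left ((Nat.dvd_lcm_right M N).mul_right c) h⟩
  have hmod : ∀ s t, (u s ≡ u t [MOD M] ∧ v s ≡ v t [MOD N]) ↔ s ≡ t [MOD M * N] := by
    intro s t
    rcases le_total s t with hst | hst
    · exact hmodle s t hst
    · have := hmodle t s hst
      exact (and_congr Nat.ModEq.comm Nat.ModEq.comm).trans (this.trans Nat.ModEq.comm)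
  have hnotS : ∀ {i}, i ∈ T → i ∉ S := fun hi hi' => Finset.disjoint_left.mp hST hi' hi
  refine ⟨fun t i => if i ∈ S then f₁ (u t) i else f₂ (v t) i,
    fun t => if u (t + 1) = u t then e₂ (v t) else e₁ (u t), ?_, ?_, ?_, ?_, ?_⟩
  · intro t
    dsimp only
    split_ifs
    · exact Finset.mem_union_right _ (he₂ _)
    · exact Finset.mem_union_left _ (he₁ _)
  · intro t
    rcases hcase t with ⟨h1, h2⟩ | ⟨h1, h2⟩
    · have hdim : (if u (t + 1) = u t then e₂ (v t) else e₁ (u t)) = e₁ (u t) :=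
        if_neg (by omega)
      beta_reduce
      rw [hdim, if_pos (he₁ _), if_pos (he₁ _), h1]
      exact hf₁ (u t)
    · have hdim : (if u (t + 1) = u t then e₂ (v t) else e₁ (u t)) = e₂ (v t) := if_pos h1
      beta_reduce
      rw [hdim, if_neg (hnotS (he₂ _)), if_neg (hnotS (he₂ _)), h2]
      exact hf₂ (v t)
  · intro t j hj hne
    rcases hcase t with ⟨h1, h2⟩ | ⟨h1, h2⟩
    · simp only [h1, Nat.add_eq_left, one_ne_zero, if_false] at hne
      by_cases hjS : j ∈ S
      · simpa [h1, hjS] using hc₁ (u t) j hjS hne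
      · simp [h2, hjS]
    · simp only [h1, if_true] at hne
      by_cases hjS : j ∈ S
      · simp [h1, hjS]
      · simpa [h2, hjS] using
          hc₂ (v t) j ((Finset.mem_union.mp hj).resolve_left hjS) hne
  · intro s t
    rw [← hmod, ← hm₁, ← hm₂]
    constructor
    · intro H
      refine ⟨fun i hi => ?_, fun i hi => ?_⟩
      · simpa [hi] using H i (Finset.mem_union_left _ hi)
      · simpa [hnotS hi] using H i (Finset.mem_union_right _ hi)
    · rintro ⟨H1, H2⟩ i hi
      by_cases hiS : i ∈ S
      · simpa [hiS] using H1 i hiS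
      · simpa [hiS] using H2 i ((Finset.mem_union.mp hi).resolve_left hiS)
  · intro s t hst htR
    have hle := humono (show s + 1 ≤ t from hst)
    have hvle := hvmono (show s + 1 ≤ t from hst)
    have hsR : t + 1 ≤ s + R := by omega
    have hub : u (t + 1) ≤ u s + r₁ := by
      have h1 := hlow (t + 1)
      have h2 := hupp s
      have h3 := Nat.mul_le_mul_right g hsR
      have : d * u (t + 1) < d * (u s + r₁ + 1) := by nlinarith
      have := lt_of_mul_lt_mul_left this (Nat.zero_le d)
      omega
    have hvb : v (t + 1) ≤ v s + r₂ := by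
      have h1 := hupp (t + 1)
      have h2 := hlow s
      have h3 := Nat.mul_le_mul_right h hsR
      have h4 : d * u (t + 1) + d * v (t + 1) = (t + 1) * g + (t + 1) * h := by
        rw [← mul_add, huv, hdef]
        ring
      have h5 : d * u s + d * v s = s * g + s * h := by
        rw [← mul_add, huv, hdef]
        ring
      have : d * v (t + 1) < d * (v s + r₂ + 1) := by nlinarith
      have := lt_of_mul_lt_mul_left this (Nat.zero_le d)
      omega
    have hne : ∀ a b, e₁ a ≠ e₂ b := fun a b hab => hnotS (he₂ b) (hab ▸ he₁ a)
    rcases hcase s with ⟨h1, h2⟩ | ⟨h1, h2⟩ <;> rcases hcase t with ⟨h3, h4⟩ | ⟨h3, h4⟩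
    · simpa [h1, h3] using hw₁ (u s) (u t) (by omega) (by omega)
    · simpa [h1, h3] using hne _ _
    · simpa [h1, h3] using (hne _ _).symm
    · simpa [h1, h3] using hw₂ (v s) (v t) (by omega) (by omega)

theorem two_pow_mul_pow_dvd {p a b z : ℕ} (hp : p.Prime) (hp2 : p ≠ 2) (h2 : 2 ^ a ∣ z)
    (h3 : p ^ b ∣ z) : 2 ^ a * p ^ b ∣ z :=
  Nat.Coprime.mul_dvd_of_dvd_of_dvd
    (Nat.Coprime.pow _ _ ((Nat.coprime_primes Nat.prime_two hp).mpr hp2.symm)) h2 h3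

theorem lcm_dvd_of_dvd_mul {p a b c e g h z : ℕ} (hp : p.Prime) (hp2 : p ≠ 2) (hg : Odd g)
    (hh : Odd h) (hgh : e ≤ b ∧ ¬ p ∣ g ∨ b ≤ e ∧ ¬ p ∣ h)
    (hM : 2 ^ a * p ^ b ∣ z * g) (hN : 2 ^ c * p ^ e ∣ z * h) :
    Nat.lcm (2 ^ a * p ^ b) (2 ^ c * p ^ e) ∣ z := by
  have h2a : 2 ^ a ∣ z := (Nat.Coprime.pow_left a (Nat.coprime_two_left.mpr hg)).dvd_of_dvd_mul_right
    ((Dvd.intro _ rfl).trans hM)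
  have h2c : 2 ^ c ∣ z := (Nat.Coprime.pow_left c (Nat.coprime_two_left.mpr hh)).dvd_of_dvd_mul_right
    ((Dvd.intro _ rfl).trans hN)
  have hpbe : p ^ b ∣ z ∧ p ^ e ∣ z := by
    rcases hgh with ⟨hle, hpg⟩ | ⟨hle, hph⟩
    · have : p ^ b ∣ z := (Nat.Coprime.pow_left b
        ((Nat.Prime.coprime_iff_not_dvd hp).mpr hpg)).dvd_of_dvd_mul_right
          ((Dvd.intro_left _ rfl).trans hM)
      exact ⟨this, (pow_dvd_pow p hle).trans this⟩
    · have : p ^ e ∣ z := (Nat.Coprime.pow_left e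
        ((Nat.Prime.coprime_iff_not_dvd hp).mpr hph)).dvd_of_dvd_mul_right
          ((Dvd.intro_left _ rfl).trans hN)
      exact ⟨(pow_dvd_pow p hle).trans this, this⟩
  exact Nat.lcm_dvd (two_pow_mul_pow_dvd hp hp2 h2a hpbe.1)
    (two_pow_mul_pow_dvd hp hp2 h2c hpbe.2)

/-- A product of numbers of the form `2 ^ q i * p ^ r i` is of that form again. -/
theorem prod_two_pow_mul_pow {ι : Type*} {sz q r : ι → ℕ} {p : ℕ}
    (hsz : ∀ i, sz i = 2 ^ q i * p ^ r i) (S : Finset ι) :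
    ∏ i ∈ S, sz i = 2 ^ (∑ i ∈ S, q i) * p ^ (∑ i ∈ S, r i) := by
  simp_rw [hsz, Finset.prod_mul_distrib, Finset.prod_pow_eq_pow_sum]

/-- Two consecutive odd numbers `g`, `g + 2` in the interval of admissible step counts suffice to
combine the two codes, since at least one of them meets the coprimality requirement. -/
theorem HasRun.union_of_odd {ι : Type*} [DecidableEq ι] {sz q r : ι → ℕ} {p : ℕ} (hp : p.Prime)
    (hp2 : p ≠ 2) (hsz : ∀ i, sz i = 2 ^ q i * p ^ r i) {S T : Finset ι} (hST : Disjoint S T)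
    {r₁ r₂ d g : ℕ} (hS : HasRun sz S (r₁ + 1)) (hT : HasRun sz T (r₂ + 1))
    (hd : Nat.gcd (∏ i ∈ S, sz i) (∏ i ∈ T, sz i) = d) (hd2 : Even d) (hg : Odd g)
    (hlow : r₁ * d ≤ (r₁ + r₂ + 1) * g) (hupp : (r₁ + r₂ + 1) * (g + 2) ≤ (r₁ + 1) * d) :
    HasRun sz (S ∪ T) (r₁ + r₂ + 1) := by
  have hgd : g + 2 ≤ d := by
    by_contra hcon
    have : d + 1 ≤ g + 2 := by omega
    nlinarith [Nat.zero_le (r₂ * d)]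
  have main : ∀ g', Odd g' → g ≤ g' → g' ≤ g + 2 →
      ((∑ i ∈ T, r i ≤ ∑ i ∈ S, r i ∧ ¬ p ∣ g') ∨ (∑ i ∈ S, r i ≤ ∑ i ∈ T, r i ∧ ¬ p ∣ d - g')) →
      HasRun sz (S ∪ T) (r₁ + r₂ + 1) := by
    intro g' hodd h1 h2 h3
    obtain ⟨h, hh⟩ : ∃ h, g' + h = d := ⟨d - g', by omega⟩
    have hh' : d - g' = h := by omega
    have hhodd : Odd h := by
      rw [← hh, Nat.even_add'] at hd2
      exact hd2.mp hodd
    refine HasRun.union hST hS hT (hh.trans hd.symm) (by omega) ?_ ?_ ?_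
    · rw [hh]
      exact (Nat.mul_le_mul_left _ h2).trans hupp
    · have h4 := Nat.mul_le_mul_left (r₁ + r₂ + 1) h1
      have h5 : (r₁ + r₂ + 1) * g' + (r₁ + r₂ + 1) * h = r₁ * d + (r₂ + 1) * d := by
        rw [← mul_add, hh]
        ring
      rw [hh]
      omega
    · intro z hM hN
      rw [prod_two_pow_mul_pow hsz] at hM hN
      rw [prod_two_pow_mul_pow hsz, prod_two_pow_mul_pow hsz]
      rw [hh'] at h3
      exact lcm_dvd_of_dvd_mul hp hp2 hodd hhodd h3 hM hN
  have hp2' : ¬ p ∣ 2 := fun h => hp2 ((Nat.prime_dvd_prime_iff_eq hp Nat.prime_two).mp h)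
  have hg2 : Odd (g + 2) := hg.add_even even_two
  rcases le_total (∑ i ∈ T, r i) (∑ i ∈ S, r i) with hle | hle
  · by_cases hpg : p ∣ g
    · exact main (g + 2) hg2 (by omega) le_rfl
        (Or.inl ⟨hle, fun h => hp2' ((Nat.dvd_add_right hpg).mp h)⟩)
    · exact main g hg le_rfl (by omega) (Or.inl ⟨hle, hpg⟩)
  · by_cases hpg : p ∣ d - g
    · refine main (g + 2) hg2 (by omega) le_rfl (Or.inr ⟨hle, fun h => hp2' ?_⟩)
      rw [show d - g = d - (g + 2) + 2 by omega] at hpg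
      exact (Nat.dvd_add_right h).mp hpg
    · exact main g hg le_rfl (by omega) (Or.inr ⟨hle, hpg⟩)

theorem exists_odd_mul_between {r R d : ℕ} (hd : 4 * R ≤ d) (hR : 0 < R) :
    ∃ g, Odd g ∧ r * d ≤ R * g ∧ R * (g + 2) ≤ (r + 1) * d := by
  have h1 : r * d < R * (r * d / R) + R := Nat.lt_mul_div_succ _ hR
  have h2 : R * (r * d / R) ≤ r * d := Nat.mul_div_le _ _
  set x := r * d / R
  rcases Nat.even_or_odd x with hx | hx
  · exact ⟨x + 1, hx.add_one, by nlinarith, by nlinarith⟩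
  · exact ⟨x + 2, hx.add_even even_two, by nlinarith, by nlinarith⟩

theorem exists_odd_mul_between_of_three_mul {m n w d : ℕ} (hn : 2 ≤ n) (hm : 0 < m)
    (hmn : 2 * m ≤ n + 2) (hnm : n ≤ 2 * m + 1) (hw : w = min (2 * m) n) (hd : 2 ^ w ∣ d)
    (hle : 3 * 2 ^ w ≤ d) :
    ∃ g, Odd g ∧ m * d ≤ (m + n / 2 + 1) * g ∧ (m + n / 2 + 1) * (g + 2) ≤ (m + 1) * d := by
  rcases (by omega : w = 2 ∨ 3 ≤ w) with rfl | hw3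
  · obtain ⟨c, rfl⟩ := hd
    rcases (by omega : m = 1 ∧ n / 2 = 1 ∨ m = 2 ∧ n / 2 = 1) with ⟨rfl, hn2⟩ | ⟨rfl, hn2⟩ <;>
      rw [hn2]
    · exact exists_odd_mul_between (by omega) (by omega)
    · rcases (by omega : c = 3 ∨ 4 ≤ c) with rfl | hc
      · exact ⟨7, by decide, by omega, by omega⟩
      · exact exists_odd_mul_between (by omega) (by omega)
  · refine exists_odd_mul_between ?_ (by omega)
    have : 4 * w + 10 ≤ 3 * 2 ^ w := by
      clear * - hw3
      induction w, hw3 using Nat.le_induction with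
      | base => norm_num
      | succ w hw ih =>
        rw [pow_succ]
        omega
    omega

theorem exists_odd_mul_between_of_two_pow_dvd {m n w d : ℕ} (hn : 2 ≤ n) (hm : 0 < m)
    (hmn : 2 * m ≤ n + 2) (hnm : n ≤ 2 * m + 1) (hw : w = min (4 * m - 1) (2 * n))
    (hd : 2 ^ w ∣ d) (hpos : 0 < d) :
    ∃ g, Odd g ∧ m * d ≤ (m + n / 2 + 1) * g ∧ (m + n / 2 + 1) * (g + 2) ≤ (m + 1) * d := by
  have hle := Nat.le_of_dvd hpos hd
  rcases (by omega : w = 3 ∨ w = 4 ∨ 5 ≤ w) with rfl | rfl | hw5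
  · obtain ⟨c, rfl⟩ := hd
    obtain rfl : m = 1 := by omega
    rw [show n / 2 = 1 by omega]
    rcases (by omega : c = 1 ∨ 2 ≤ c) with rfl | hc
    · exact ⟨3, by decide, by omega, by omega⟩
    · exact exists_odd_mul_between (by omega) (by omega)
  · exact exists_odd_mul_between (by omega) (by omega)
  · refine exists_odd_mul_between ?_ (by omega)
    have : 2 * w + 11 ≤ 2 ^ w := by
      clear * - hw5
      induction w, hw5 using Nat.le_induction with
      | base => norm_num
      | succ w hw ih =>
        rw [pow_succ]
        omega
    omega

/-- A set with at least four factors splits into two parts of nearly equal size, the first of even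
size, such that the gcd of the two products leaves room for two consecutive odd step counts. -/
theorem exists_split {ι : Type*} [DecidableEq ι] {sz q r : ι → ℕ} {p : ℕ} (hp : p.Prime)
    (hp2 : p ≠ 2) (hsz : ∀ i, sz i = 2 ^ q i * p ^ r i) (hq : ∀ i, 1 ≤ q i)
    (hq2 : ∀ i, r i = 0 → 2 ≤ q i) (S : Finset ι) {m n : ℕ} (hmn : S.card = 2 * m + n)
    (hm : 0 < m) (hmn1 : 2 * m ≤ n + 2) (hn1 : n ≤ 2 * m + 1) (hcard : 4 ≤ S.card) :
    ∃ T ⊆ S, T.card = 2 * m ∧ ∃ d g,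
      Nat.gcd (∏ i ∈ T, sz i) (∏ i ∈ S \ T, sz i) = d ∧ Even d ∧ Odd g ∧
      m * d ≤ (m + n / 2 + 1) * g ∧ (m + n / 2 + 1) * (g + 2) ≤ (m + 1) * d := by
  have hgcd : ∀ T : Finset ι, 0 < Nat.gcd (∏ i ∈ T, sz i) (∏ i ∈ S \ T, sz i) := fun T => by
    rw [prod_two_pow_mul_pow hsz]
    have := hp.pos
    exact Nat.gcd_pos_of_pos_left _ (by positivity)
  have hsumq : ∀ U : Finset ι, U.card ≤ ∑ i ∈ U, q i := fun U => by
    simpa using Finset.card_nsmul_le_sum U q 1 fun i _ => hq i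
  have hsub : ∀ T ⊆ S, T.card = 2 * m → (S \ T).card = n := fun T hTS hT => by
    rw [Finset.card_sdiff_of_subset hTS]
    omega
  by_cases hex : ∃ x ∈ S, ∃ y ∈ S, r x ≠ 0 ∧ r y ≠ 0 ∧ x ≠ y
  · obtain ⟨x, hxS, y, hyS, hx, hy, hxy⟩ := hex
    obtain ⟨T, hxT, hTS, hT⟩ := Finset.exists_subsuperset_card_eq (s := {x}) (t := S.erase y)
      (n := 2 * m) (by simp [hxy, hxS]) (by rw [Finset.card_singleton]; omega)
      (by rw [Finset.card_erase_of_mem hyS]; omega)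
    have hxT : x ∈ T := Finset.singleton_subset_iff.mp hxT
    have hyT : y ∈ S \ T :=
      Finset.mem_sdiff.mpr ⟨hyS, fun h => Finset.notMem_erase y S (hTS h)⟩
    have hTS := hTS.trans (Finset.erase_subset y S)
    have hdvd : ∀ U : Finset ι, ∀ z ∈ U, r z ≠ 0 → min (2 * m) n ≤ U.card →
        2 ^ min (2 * m) n * p ∣ ∏ i ∈ U, sz i := by
      intro U z hz hrz hU
      rw [prod_two_pow_mul_pow hsz]
      refine mul_dvd_mul (pow_dvd_pow 2 (hU.trans (hsumq U))) (dvd_pow_self p ?_)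
      exact fun h => hrz (Finset.sum_eq_zero_iff.mp h z hz)
    have hd := Nat.dvd_gcd (hdvd T x hxT hx (by omega))
      (hdvd (S \ T) y hyT hy (by rw [hsub T hTS hT]; omega))
    have hle := Nat.le_of_dvd (hgcd T) hd
    have hp3 : 3 ≤ p := by
      have := hp.two_le
      omega
    obtain ⟨g, hg⟩ := exists_odd_mul_between_of_three_mul (by omega) hm hmn1 hn1 rfl
      ((Dvd.intro _ rfl).trans hd) (by nlinarith [Nat.mul_le_mul_left (2 ^ min (2 * m) n) hp3])
    refine ⟨T, hTS, hT, _, g, rfl, ?_, hg⟩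
    exact even_iff_two_dvd.mpr
      (((dvd_pow_self 2 (by omega)).trans (Dvd.intro _ rfl)).trans hd)
  · have hB : (S.filter fun i => r i ≠ 0).card ≤ 1 := by
      refine Finset.card_le_one.mpr fun x hx y hy => ?_
      rw [Finset.mem_filter] at hx hy
      by_contra hxy
      exact hex ⟨x, hx.1, y, hy.1, hx.2, hy.2, hxy⟩
    obtain ⟨T, hBT, hTS, hT⟩ := Finset.exists_subsuperset_card_eq (n := 2 * m)
      (Finset.filter_subset (fun i => r i ≠ 0) S) (by omega) (by omega)
    have hdvd : ∀ U : Finset ι, min (4 * m - 1) (2 * n) ≤ ∑ i ∈ U, q i →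
        2 ^ min (4 * m - 1) (2 * n) ∣ ∏ i ∈ U, sz i := by
      intro U hU
      rw [prod_two_pow_mul_pow hsz]
      exact (pow_dvd_pow 2 hU).trans (Dvd.intro _ rfl)
    have hqT : 4 * m ≤ ∑ i ∈ T, q i + 1 := by
      have h1 : T.card * 2 ≤ ∑ i ∈ T, (q i + if r i ≠ 0 then 1 else 0) :=
        Finset.card_nsmul_le_sum T _ 2 fun i _ => by
          have := hq i
          have := hq2 i
          split_ifs <;> omega
      rw [Finset.sum_add_distrib, ← Finset.card_filter] at h1
      have h2 := Finset.card_le_card (Finset.filter_subset_filter (fun i => r i ≠ 0) hTS)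
      omega
    have hqT' : 2 * n ≤ ∑ i ∈ S \ T, q i := by
      have h1 : (S \ T).card * 2 ≤ ∑ i ∈ S \ T, q i :=
        Finset.card_nsmul_le_sum _ _ 2 fun i hi => hq2 i <| by
          rw [Finset.mem_sdiff] at hi
          by_contra hr
          exact hi.2 (hBT (Finset.mem_filter.mpr ⟨hi.1, hr⟩))
      rw [hsub T hTS hT] at h1
      omega
    have hd := Nat.dvd_gcd (hdvd T (by omega)) (hdvd (S \ T) (by omega))
    obtain ⟨g, hg⟩ := exists_odd_mul_between_of_two_pow_dvd (by omega) hm hmn1 hn1 rfl hd (hgcd T)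
    refine ⟨T, hTS, hT, _, g, rfl, ?_, hg⟩
    exact even_iff_two_dvd.mpr ((dvd_pow_self 2 (by omega)).trans hd)

theorem hasRun_of_two_pow_mul_pow {ι : Type*} [DecidableEq ι] {sz q r : ι → ℕ} {p : ℕ}
    (hp : p.Prime) (hp2 : p ≠ 2) (hsz : ∀ i, sz i = 2 ^ q i * p ^ r i) (hq : ∀ i, 1 ≤ q i)
    (hq2 : ∀ i, r i = 0 → 2 ≤ q i) (S : Finset ι) (hS : S.Nonempty) :
    HasRun sz S (S.card / 2 + 1) := by
  induction hc : S.card using Nat.strong_induction_on generalizing S with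
  | _ c ih =>
  have hpos := hS.card_pos
  have heven : ∀ i, Even (sz i) := fun i => by
    rw [hsz]
    exact ((even_two.pow_of_ne_zero (by have := hq i; omega)).mul_right _)
  have hpos' : ∀ i, 0 < sz i := fun i => by
    rw [hsz]
    have := hp.pos
    positivity
  rcases (by omega : c = 1 ∨ c = 2 ∨ c = 3 ∨ 4 ≤ c) with rfl | rfl | rfl | h4
  · obtain ⟨i, rfl⟩ := Finset.card_eq_one.mp hc
    exact hasRun_singleton sz i
  · obtain ⟨i, j, hij, rfl⟩ := Finset.card_eq_two.mp hc
    exact hasRun_pair sz hij (heven i) (hpos' i) (heven j)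
  · obtain ⟨x, hxS, hx⟩ : ∃ x ∈ S, r x ≠ 0 ∨ ∀ y ∈ S, r y = 0 := by
      by_cases h : ∃ x ∈ S, r x ≠ 0
      · obtain ⟨x, hxS, hx⟩ := h
        exact ⟨x, hxS, Or.inl hx⟩
      · push Not at h
        obtain ⟨x, hxS⟩ := hS
        exact ⟨x, hxS, Or.inr h⟩
    have hT : (S.erase x).card = 2 := by rw [Finset.card_erase_of_mem hxS, hc]
    have hTne : (S.erase x).Nonempty := Finset.card_pos.mp (by omega)
    have hrun := ih 2 (by omega) (S.erase x) hTne hT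
    have hST : Disjoint (S.erase x) {x} := by simp
    have hU : S.erase x ∪ {x} = S := by
      rw [Finset.union_comm, ← Finset.insert_eq, Finset.insert_erase hxS]
    have hMne : Even (∏ i ∈ S.erase x, sz i) := by
      obtain ⟨y, hy⟩ := hTne
      exact even_iff_two_dvd.mpr ((even_iff_two_dvd.mp (heven y)).trans (Finset.dvd_prod_of_mem _ hy))
    obtain ⟨d, hd⟩ : ∃ d, Nat.gcd (∏ i ∈ S.erase x, sz i) (∏ i ∈ {x}, sz i) = d := ⟨_, rfl⟩
    have hd2 : 2 ∣ d := by
      rw [← hd, Finset.prod_singleton]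
      exact Nat.dvd_gcd (even_iff_two_dvd.mp hMne) (even_iff_two_dvd.mp (heven x))
    have hdpos : 0 < d := by
      rw [← hd, Finset.prod_singleton]
      exact Nat.gcd_pos_of_pos_right _ (hpos' x)
    obtain ⟨g, hg⟩ : ∃ g, g + 1 = d := ⟨d - 1, by omega⟩
    rw [← hU]
    refine HasRun.union hST hrun (hasRun_singleton sz x) (hg.trans hd.symm) (by omega) (by omega)
      (by omega) ?_
    intro z hM hN
    rw [prod_two_pow_mul_pow hsz] at hM hN
    rw [prod_two_pow_mul_pow hsz, prod_two_pow_mul_pow hsz]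
    refine lcm_dvd_of_dvd_mul hp hp2 (Nat.odd_iff.mpr (by omega)) odd_one ?_ hM hN
    rcases le_total (∑ i ∈ {x}, r i) (∑ i ∈ S.erase x, r i) with hle | hle
    · rcases hx with hx | hx
      · left
        refine ⟨hle, fun hpg => hp.one_lt.ne' ?_⟩
        rw [Finset.sum_singleton] at hle
        have hpd : p ∣ d := by
          rw [← hd, prod_two_pow_mul_pow hsz, prod_two_pow_mul_pow hsz, Finset.sum_singleton,
            Finset.sum_singleton]
          exact Nat.dvd_gcd (Dvd.dvd.mul_left (dvd_pow_self p (by omega)) _)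
            (Dvd.dvd.mul_left (dvd_pow_self p hx) _)
        rw [← hg] at hpd
        exact Nat.dvd_one.mp ((Nat.dvd_add_right hpg).mp hpd)
      · right
        refine ⟨?_, fun h => hp.one_lt.ne' (Nat.dvd_one.mp h)⟩
        rw [Finset.sum_eq_zero fun y hy => hx y (Finset.mem_of_mem_erase hy)]
        exact Nat.zero_le _
    · exact Or.inr ⟨hle, fun h => hp.one_lt.ne' (Nat.dvd_one.mp h)⟩
  · obtain ⟨T, hTS, hT, d, g, hd, hd2, hg, hlow, hupp⟩ := exists_split hp hp2 hsz hq hq2 S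
      (m := (c + 2) / 4) (n := c - 2 * ((c + 2) / 4)) (by omega) (by omega) (by omega) (by omega)
      (by omega)
    have hT' : (S \ T).card = c - 2 * ((c + 2) / 4) := by
      rw [Finset.card_sdiff_of_subset hTS, hc, hT]
    have h1 := ih _ (by omega) T (Finset.card_pos.mp (by omega)) hT
    have h2 := ih _ (by omega) (S \ T) (Finset.card_pos.mp (by omega)) hT'
    rw [Nat.mul_div_cancel_left _ two_pos] at h1
    have h3 := HasRun.union_of_odd hp hp2 hsz Finset.disjoint_sdiff h1 h2 hd hd2 hg hlow hupp
    rw [Finset.union_sdiff_of_subset hTS] at h3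
    rwa [show (c + 2) / 4 + (c - 2 * ((c + 2) / 4)) / 2 + 1 = c / 2 + 1 by omega] at h3

theorem WindowOk.le {k : ℕ} {sz : Fin k → ℕ} (hsz : ∀ i, 3 ≤ sz i)
    {f : ZMod (torusCard k sz) → TorusVtx k sz} (hf : IsHamCycle f) {r : ℕ} (hr : WindowOk f r) :
    r ≤ k := by
  by_contra! hlt
  have hdim : ∀ t, ∃ i, EdgeInDim f i t := by
    intro t
    obtain ⟨i, hi, -⟩ := hf.2 t
    have : Fact (1 < sz i) := ⟨by have := hsz i; omega⟩
    refine ⟨i, fun heq => ?_⟩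
    rcases hi with hi | hi
    · rw [heq] at hi
      exact one_ne_zero (left_eq_add.mp hi)
    · rw [heq] at hi
      exact one_ne_zero (left_eq_add.mp hi)
  choose e he using hdim
  obtain ⟨a, b, hab, heq⟩ := Fintype.exists_ne_map_eq_of_card_lt
    (fun a : Fin r => e (0 + ((a : ℕ) : ZMod (torusCard k sz)))) (by simpa using hlt)
  refine hr 0 _ a b a.2 b.2 (fun h => hab (Fin.ext h)) ⟨he _, ?_⟩
  rw [heq]
  exact he _

theorem runLength_le {k : ℕ} {sz : Fin k → ℕ} (hsz : ∀ i, 3 ≤ sz i)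
    {f : ZMod (torusCard k sz) → TorusVtx k sz} (hf : IsHamCycle f) : runLength f ≤ k :=
  csSup_le' fun _ hr => WindowOk.le hsz hf hr.2

theorem HasRun.le_mrl {k : ℕ} {sz : Fin k → ℕ} (hsz : ∀ i, 3 ≤ sz i) {r : ℕ} (hr : 1 ≤ r)
    (h : HasRun sz Finset.univ r) : r ≤ mrl k sz := by
  obtain ⟨f, e, -, hf, hc, hm, hw⟩ := h
  have hN : ∏ i, sz i = torusCard k sz := rfl
  rw [hN] at hm
  have hpos : ∀ i, NeZero (sz i) := fun i => ⟨by have := hsz i; omega⟩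
  have hNpos : NeZero (torusCard k sz) :=
    ⟨Finset.prod_ne_zero_iff.mpr fun i _ => (hpos i).ne⟩
  have hm' : ∀ s t, f s = f t ↔ s ≡ t [MOD torusCard k sz] := fun s t => by
    rw [← hm s t, funext_iff]
    simp
  let F : ZMod (torusCard k sz) → TorusVtx k sz := fun x => f x.val
  have hF : ∀ n : ℕ, F n = f n := fun n => (hm' _ _).mpr (by
    rw [ZMod.val_natCast]
    exact Nat.mod_modEq _ _)
  have hinj : Function.Injective F := fun x y hxy => by
    have := (ZMod.natCast_eq_natCast_iff _ _ _).mpr ((hm' _ _).mp hxy)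
    simpa using this
  have : Fintype (TorusVtx k sz) := inferInstanceAs (Fintype (∀ i, ZMod (sz i)))
  have hcard : Fintype.card (ZMod (torusCard k sz)) = Fintype.card (TorusVtx k sz) := by
    rw [ZMod.card, ← Nat.card_eq_fintype_card]
    change _ = Nat.card (∀ i, ZMod (sz i))
    rw [Nat.card_pi]
    simp [torusCard]
  have hham : IsHamCycle F := by
    refine ⟨(Fintype.bijective_iff_injective_and_card F).mpr ⟨hinj, hcard⟩, fun t => ?_⟩
    obtain ⟨n, rfl⟩ := ZMod.natCast_zmod_surjective t
    rw [← Nat.cast_succ, hF, hF]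
    exact ⟨e n, hf n, fun j hj => (hc n j (Finset.mem_univ j) hj).symm⟩
  have hwin : WindowOk F r := by
    have hdim : ∀ (n : ℕ) (i : Fin k), EdgeInDim F i n → i = e n := by
      intro n i hi
      rw [EdgeInDim, ← Nat.cast_succ, hF, hF] at hi
      by_contra hne
      exact hi (hc n i (Finset.mem_univ i) hne).symm
    rintro t i a b ha hb hab ⟨h1, h2⟩
    obtain ⟨n, rfl⟩ := ZMod.natCast_zmod_surjective t
    rw [← Nat.cast_add] at h1 h2
    have h3 := (hdim _ _ h1).symm.trans (hdim _ _ h2)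
    rcases lt_or_gt_of_ne hab with hlt | hlt
    · exact hw (n + a) (n + b) (by omega) (by omega) h3
    · exact hw (n + b) (n + a) (by omega) (by omega) h3.symm
  have hrun : r ≤ runLength F :=
    le_csSup ⟨k, fun s hs => WindowOk.le hsz hham hs.2⟩ ⟨hr, hwin⟩
  refine hrun.trans (le_csSup ⟨k, ?_⟩ ⟨F, hham, rfl⟩)
  rintro _ ⟨f', hf', rfl⟩
  exact runLength_le hsz hf'

/-- **Application 4.**  Let `p` be a prime, `k ≥ 2`, and let
`G = γ₁ × ⋯ × γ_k` be a torus such that each `γ_i` has `2^{q_i} · p^{r_i}`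
vertices for some integers `q_i ≥ 1` and `r_i ≥ 0`.
Then `mrl(G) ≥ ⌊k/2⌋ + 1`. -/
theorem mrl_two_pow_prime_power_general
    (p : ℕ) (hp : p.Prime) (k : ℕ) (hk : 2 ≤ k)
    (sz : Fin k → ℕ) (hsz : ∀ i, 3 ≤ sz i)
    (hform : ∀ i, ∃ q r : ℕ, 1 ≤ q ∧ sz i = 2 ^ q * p ^ r) :
    k / 2 + 1 ≤ mrl k sz := by
  obtain ⟨p', hp', hp2', q, r, hq, hform'⟩ : ∃ p' : ℕ, p'.Prime ∧ p' ≠ 2 ∧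
      ∃ q r : Fin k → ℕ, (∀ i, 1 ≤ q i) ∧ ∀ i, sz i = 2 ^ q i * p' ^ r i := by
    choose q r hq hqr using hform
    by_cases hp2 : p = 2
    · refine ⟨3, Nat.prime_three, by norm_num, fun i => q i + r i, fun _ => 0, fun i => ?_,
        fun i => ?_⟩
      · exact (hq i).trans (Nat.le_add_right _ _)
      · rw [hqr, hp2, pow_add, pow_zero, mul_one]
    · exact ⟨p, hp, hp2, q, r, hq, hqr⟩
  have hq2 : ∀ i, r i = 0 → 2 ≤ q i := by
    intro i hi
    have h1 := hsz i
    have h2 := hq i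
    rw [hform', hi, pow_zero, mul_one] at h1
    by_contra hcon
    rw [show q i = 1 by omega] at h1
    omega
  have : Nonempty (Fin k) := ⟨⟨0, by omega⟩⟩
  have h := hasRun_of_two_pow_mul_pow hp' hp2' hform' hq hq2 Finset.univ Finset.univ_nonempty
  rw [Finset.card_univ, Fintype.card_fin] at h
  exact h.le_mrl hsz (Nat.le_add_left 1 _)
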